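/- arXiv:2005.12988 — 3 statements merged into one kernel-verified Lean document; each statement's English description precedes it below -/
import Mathlib

section
/- Let n ≥ 1 and let d = 2e be an even positive integer. The subspace of O(n)-invariant tensors in V^{⊗d} (the d-fold tensor power of V = EuclideanSpace ℝ (Fin n)) is equal to the ℝ-linear span of the tensors T_σ, where σ ranges over all Brauer diagrams (fixed-point-free involutions) on d vertices. -/
open scoped TensorProduct

/-- A Brauer diagram on `d` vertices: a fixed-point-free involution of `Fin d`. -/
def IsBrauerDiagram {d : ℕ} (σ : Equiv.Perm (Fin d)) : Prop :=
  (∀ x, σ (σ x) = x) ∧ ∀ x, σ x ≠ x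

/-- The tensor associated to a Brauer diagram `σ`:
`T_σ = Σ_{i : Fin d → Fin n, i∘σ = i} e_{i 1} ⊗ ⋯ ⊗ e_{i d}`. -/
noncomputable def brauerTensor (n d : ℕ) (σ : Equiv.Perm (Fin d)) :
    ⨂[ℝ] _ : Fin d, EuclideanSpace ℝ (Fin n) :=
  ∑ i ∈ Finset.univ.filter (fun i : Fin d → Fin n => i ∘ ⇑σ = i),
    PiTensorProduct.tprod ℝ (fun t => EuclideanSpace.single (i t) (1 : ℝ))

section OrthogonalInvariants

open Matrix

lemma sum_sum_update {α ι : Type} [Fintype α] [Fintype ι] [DecidableEq ι]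
    (t : ι) (g : (ι → α) → ℝ) :
    ∑ I : ι → α, ∑ q, g (Function.update I t q) = Fintype.card α * ∑ I, g I := by
  have h : ∑ p : (ι → α) × α, g (Function.update p.1 t p.2) = ∑ p : (ι → α) × α, g p.1 :=
    Finset.sum_nbij' (fun p => (Function.update p.1 t p.2, p.1 t))
      (fun p => (Function.update p.1 t p.2, p.1 t)) (by simp) (by simp) (by simp) (by simp)
      (by simp)
  rw [Fintype.sum_prod_type, Fintype.sum_prod_type] at h
  simpa [Finset.mul_sum] using h

lemma sum_sumArrow {α κ : Type} [Fintype α] [Fintype κ] [DecidableEq κ]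
    (F : (κ ⊕ Fin 2 → α) → ℝ) :
    ∑ L, F L = ∑ J : κ → α, ∑ p, ∑ q, F (Sum.elim J ![p, q]) := by
  rw [← (Equiv.sumArrowEquivProdArrow κ (Fin 2) α).symm.sum_comp, Fintype.sum_prod_type]
  refine Finset.sum_congr rfl fun J _ => ?_
  rw [← (finTwoArrowEquiv α).symm.sum_comp, Fintype.sum_prod_type]
  rfl

lemma exists_sumEquiv_of_ne {ι : Type} [DecidableEq ι]
    {t u : ι} (h : t ≠ u) :
    ∃ (p : ι → Prop) (_ : DecidablePred p) (e : {x // p x} ⊕ Fin 2 ≃ ι),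
      e (Sum.inr 0) = t ∧ e (Sum.inr 1) = u := by
  have hinj : Function.Injective ![t, u] := by
    intro i j
    fin_cases i <;> fin_cases j <;> simp [h, h.symm]
  refine ⟨fun x => x ∈ (Set.range ![t, u])ᶜ, inferInstance,
    ((Equiv.sumComm _ _).trans (Equiv.sumCongr (Equiv.ofInjective _ hinj) (Equiv.refl _))).trans
      (Equiv.Set.sumCompl (Set.range ![t, u])), ?_, ?_⟩ <;> simp

lemma exists_sumEquiv_of_involutive {ι : Type} [Fintype ι]
    (σ : Equiv.Perm ι) (h2 : ∀ x, σ (σ x) = x)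
    (hne : ∀ x, σ x ≠ x) :
    ∃ (p : ι → Prop) (_ : DecidablePred p) (f : {x // p x} ⊕ {x // p x} ≃ ι),
      ∀ x, f (Sum.inr x) = σ (f (Sum.inl x)) := by
  let e := Fintype.equivFin ι
  refine ⟨fun x => e x < e (σ x), inferInstance,
    Equiv.ofBijective (Sum.elim Subtype.val fun x => σ x) ⟨?_, fun x => ?_⟩, fun x => rfl⟩
  · rintro (⟨x, hx⟩ | ⟨x, hx⟩) (⟨y, hy⟩ | ⟨y, hy⟩) h
    · simpa using h
    · obtain rfl : x = σ y := h
      rw [h2] at hx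
      exact absurd hx hy.asymm
    · obtain rfl : σ x = y := h
      rw [h2] at hy
      exact absurd hx hy.asymm
    · simpa using h
  · rcases lt_trichotomy (e x) (e (σ x)) with h | h | h
    · exact ⟨Sum.inl ⟨x, h⟩, rfl⟩
    · exact absurd (e.injective h).symm (hne x)
    · exact ⟨Sum.inr ⟨σ x, by simpa only [h2] using h⟩, h2 x⟩

variable {α ι κ : Type} [Fintype α] [DecidableEq α] [Fintype ι] [DecidableEq ι]
  [Fintype κ] [DecidableEq κ]

/-- The coefficient array `c` of a tensor is invariant under the orthogonal group. -/
def IsOrthogonalInvariant (c : (ι → α) → ℝ) : Prop :=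
  ∀ A ∈ orthogonalGroup α ℝ, ∀ I, ∑ J, (∏ t, A (I t) (J t)) * c J = c I

/-- The coefficient array `c` is orthogonal to the tensors of all Brauer diagrams. -/
def IsOrthogonalToBrauer (c : (ι → α) → ℝ) : Prop :=
  ∀ σ : Equiv.Perm ι, (∀ x, σ (σ x) = x) → (∀ x, σ x ≠ x) →
    ∑ I : ι → α, (if I ∘ σ = I then c I else 0) = 0

lemma one_add_sin_smul_add_mem_orthogonalGroup {K : Matrix α α ℝ} (hK : Kᵀ = -K)
    (hK3 : K * K * K = -K) (θ : ℝ) :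
    1 + Real.sin θ • K + (1 - Real.cos θ) • (K * K) ∈ orthogonalGroup α ℝ := by
  rw [mem_orthogonalGroup_iff]
  have hT : (1 + Real.sin θ • K + (1 - Real.cos θ) • (K * K))ᵀ =
      1 - Real.sin θ • K + (1 - Real.cos θ) • (K * K) := by
    simp [transpose_mul, hK, sub_eq_add_neg]
  have hK4 : K * K * (K * K) = -(K * K) := by rw [← mul_assoc, hK3, neg_mul]
  have hK3' : K * (K * K) = -K := by rw [← mul_assoc, hK3]
  have hcoef : 2 * (1 - Real.cos θ) - Real.sin θ ^ 2 - (1 - Real.cos θ) ^ 2 = 0 := by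
    linear_combination -Real.sin_sq_add_cos_sq θ
  have hexp : (1 + Real.sin θ • K + (1 - Real.cos θ) • (K * K)) *
      (1 - Real.sin θ • K + (1 - Real.cos θ) • (K * K)) =
      1 + (2 * (1 - Real.cos θ) - Real.sin θ ^ 2 - (1 - Real.cos θ) ^ 2) • (K * K) := by
    simp only [add_mul, mul_add, mul_sub, one_mul, mul_one, smul_mul_assoc,
      mul_smul_comm, hK4, hK3', hK3]
    module
  rw [hT, hexp, hcoef, zero_smul, add_zero]

lemma sum_prod_erase_one_mul (I : ι → α) (t : ι) (F : (ι → α) → ℝ) :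
    ∑ J : ι → α, (∏ s ∈ Finset.univ.erase t, (1 : Matrix α α ℝ) (I s) (J s)) * F J =
      ∑ j, F (Function.update I t j) := by
  simp only [one_apply, Finset.prod_ite_zero, Finset.prod_const_one, ite_mul, one_mul, zero_mul,
    ← Finset.sum_filter]
  refine Finset.sum_nbij' (fun J => J t) (fun j => Function.update I t j) ?_ ?_ ?_ ?_ ?_
  · simp
  · intro j _
    simp +contextual [Function.update_of_ne]
  · intro J hJ
    simp only [Finset.mem_erase, Finset.mem_filter, Finset.mem_univ, true_and, and_true] at hJ
    ext s
    by_cases h : s = t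
    · subst h; simp
    · simp [h, hJ s h]
  · simp
  · intro J hJ
    simp only [Finset.mem_erase, Finset.mem_filter, Finset.mem_univ, true_and, and_true] at hJ
    congr 1
    ext s
    by_cases h : s = t
    · subst h; simp
    · simp [h, hJ s h]

/-- The infinitesimal form of orthogonal invariance. -/
lemma IsOrthogonalInvariant.sum_skew_update_eq_zero {c : (ι → α) → ℝ}
    (hc : IsOrthogonalInvariant c) {K : Matrix α α ℝ} (hK : Kᵀ = -K) (hK3 : K * K * K = -K)
    (I : ι → α) : ∑ t, ∑ j, K (I t) j * c (Function.update I t j) = 0 := by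
  have hR : ∀ i j, HasDerivAt
      (fun θ : ℝ => (1 + Real.sin θ • K + (1 - Real.cos θ) • (K * K)) i j) (K i j) 0 := by
    intro i j
    have h := (((Real.hasDerivAt_sin 0).mul_const (K i j)).const_add
      ((1 : Matrix α α ℝ) i j)).add
      (((Real.hasDerivAt_cos 0).const_sub 1).mul_const ((K * K) i j))
    simpa [Pi.add_def] using h
  have hderiv := HasDerivAt.fun_sum (u := Finset.univ) fun (J : ι → α) _ =>
    (HasDerivAt.fun_finsetProd (u := Finset.univ) fun (t : ι) _ =>
      hR (I t) (J t)).mul_const (c J)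
  have hconst := hderiv.unique ((hasDerivAt_const (0 : ℝ) (c I)).congr_of_eventuallyEq
    (Filter.Eventually.of_forall fun θ =>
      hc _ (one_add_sin_smul_add_mem_orthogonalGroup hK hK3 θ) I))
  simp only [Real.sin_zero, Real.cos_zero, sub_self, zero_smul, add_zero, smul_eq_mul,
    Finset.sum_mul, mul_assoc] at hconst
  rw [Finset.sum_comm] at hconst
  rw [← hconst]
  refine Finset.sum_congr rfl fun t _ => ?_
  rw [sum_prod_erase_one_mul I t fun J => K (I t) (J t) * c J]
  simp

lemma IsOrthogonalInvariant.sum_ite_update_comm {c : (ι → α) → ℝ}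
    (hc : IsOrthogonalInvariant c) (a b : α) (I : ι → α) :
    ∑ t, (if I t = a then c (Function.update I t b) else 0) =
      ∑ t, (if I t = b then c (Function.update I t a) else 0) := by
  rcases eq_or_ne a b with rfl | hab
  · rfl
  have h := hc.sum_skew_update_eq_zero
    (K := Matrix.single a b 1 - Matrix.single b a 1) (by simp)
    (by
      simp only [sub_mul, mul_sub]
      simp [hab, hab.symm]
      abel) I
  rw [← sub_eq_zero, ← Finset.sum_sub_distrib]
  refine Eq.trans ?_ h
  refine Finset.sum_congr rfl fun t _ => ?_
  simp only [Matrix.sub_apply, Matrix.single_apply, sub_mul, Finset.sum_sub_distrib, ite_and,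
    ite_mul, one_mul, zero_mul, eq_comm (b := I t)]
  split_ifs <;> simp

lemma IsOrthogonalInvariant.even_card {c : (ι → α) → ℝ} (hc : IsOrthogonalInvariant c)
    {I : ι → α} (hI : c I ≠ 0) (a : α) : Even (Finset.univ.filter fun t => I t = a).card := by
  by_contra hodd
  rw [Nat.not_even_iff_odd] at hodd
  have h := hc (diagonal fun i => if i = a then -1 else 1) (by
    rw [mem_orthogonalGroup_iff, diagonal_transpose, diagonal_mul_diagonal, ← diagonal_one]
    congr 1
    ext i
    split_ifs <;> simp) I
  rw [Finset.sum_eq_single I] at h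
  · simp only [diagonal_apply_eq, Finset.prod_ite, Finset.prod_const, one_pow,
      mul_one, hodd.neg_one_pow] at h
    apply hI
    linarith
  · intro J _ hJ
    obtain ⟨t, ht⟩ := Function.ne_iff.1 hJ
    exact mul_eq_zero_of_left
      (Finset.prod_eq_zero (Finset.mem_univ t) (diagonal_apply_ne (n := α) _ ht.symm)) _
  · simp

/-- An orthogonally invariant array all of whose contractions vanish is zero. -/
theorem IsOrthogonalInvariant.eq_zero_of_traceless [Nonempty α] [Nonempty ι] {c : (ι → α) → ℝ}
    (hc : IsOrthogonalInvariant c)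
    (htr : ∀ t u, t ≠ u → ∀ I, ∑ q, c (Function.update (Function.update I t q) u q) = 0) :
    c = 0 := by
  have hoff : ∀ t u, t ≠ u →
      ∑ I : ι → α, c (Function.update I t (I u)) * c (Function.update I u (I t)) = 0 := by
    intro t u htu
    have h := sum_sum_update t fun I : ι → α =>
      c (Function.update I t (I u)) * c (Function.update I u (I t))
    simp only [Function.update_idem, Function.update_self, Function.update_of_ne htu.symm,
      ← Finset.mul_sum, htr t u htu, mul_zero, Finset.sum_const_zero] at h
    simpa using h.symm
  have hdiag : ∀ t, ∑ I : ι → α,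
      c (Function.update I t (I t)) * c (Function.update I t (I t)) = ∑ I, c I ^ 2 := by
    intro t
    simp [sq]
  have hsum : ∑ I : ι → α, ∑ a, ∑ b,
      (∑ t, if I t = a then c (Function.update I t b) else 0) ^ 2 =
      Fintype.card ι * ∑ I, c I ^ 2 := by
    have hI : ∀ I : ι → α, ∑ a, ∑ b,
        (∑ t, if I t = a then c (Function.update I t b) else 0) ^ 2 =
        ∑ t, ∑ u, c (Function.update I t (I u)) * c (Function.update I u (I t)) := by
      intro I
      have hab : ∀ a b, (∑ t, if I t = a then c (Function.update I t b) else 0) ^ 2 =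
          ∑ t, ∑ u, if I t = a then if I u = b then
            c (Function.update I t b) * c (Function.update I u a) else 0 else 0 := by
        intro a b
        rw [sq]
        nth_rw 2 [hc.sum_ite_update_comm]
        rw [Finset.sum_mul_sum]
        refine Finset.sum_congr rfl fun t _ => Finset.sum_congr rfl fun u _ => ?_
        split_ifs <;> simp
      simp only [hab]
      calc _ = ∑ t, ∑ u, ∑ a, ∑ b, (if I t = a then if I u = b then
            c (Function.update I t b) * c (Function.update I u a) else 0 else 0) := by
            simp only [Finset.sum_comm (s := (Finset.univ : Finset α))
              (t := (Finset.univ : Finset ι))]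
        _ = _ := by
            refine Finset.sum_congr rfl fun t _ => Finset.sum_congr rfl fun u _ => ?_
            rw [Finset.sum_comm]
            simp
    simp only [hI]
    rw [Finset.sum_comm]
    have : ∀ t, ∑ I : ι → α, ∑ u,
        c (Function.update I t (I u)) * c (Function.update I u (I t)) = ∑ I, c I ^ 2 := by
      intro t
      rw [Finset.sum_comm, Finset.sum_eq_single t (fun u _ h => hoff t u h.symm) (by simp), hdiag]
    simp [this]
  have hlow : ∀ I : ι → α, 2 * Fintype.card ι * c I ^ 2 ≤ ∑ a, ∑ b,
      (∑ t, if I t = a then c (Function.update I t b) else 0) ^ 2 := by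
    intro I
    have haa : ∀ a, ∑ t, (if I t = a then c (Function.update I t a) else 0) =
        (Finset.univ.filter fun t => I t = a).card * c I := by
      intro a
      rw [← Finset.sum_filter, ← nsmul_eq_mul, ← Finset.sum_const]
      refine Finset.sum_congr rfl fun t ht => ?_
      rw [← (Finset.mem_filter.1 ht).2, Function.update_eq_self]
    have hcard : (Fintype.card ι : ℝ) =
        ∑ a, ((Finset.univ.filter fun t => I t = a).card : ℝ) := by
      rw [← Nat.cast_sum, ← Finset.card_eq_sum_card_fiberwise (by simp), Finset.card_univ]
    rw [hcard, Finset.mul_sum, Finset.sum_mul]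
    refine Finset.sum_le_sum fun a _ => ?_
    refine le_trans ?_ (Finset.single_le_sum (fun b _ => sq_nonneg _) (Finset.mem_univ a))
    rw [haa, mul_pow]
    rcases eq_or_ne (c I) 0 with h0 | h0
    · simp [h0]
    obtain ⟨k, hk⟩ := hc.even_card h0 a
    refine mul_le_mul_of_nonneg_right ?_ (sq_nonneg _)
    rw [hk]
    have : (k : ℝ) ≤ (k : ℝ) ^ 2 := by exact_mod_cast Nat.le_self_pow two_ne_zero k
    push_cast
    nlinarith
  have hle := Finset.sum_le_sum fun (I : ι → α) (_ : I ∈ Finset.univ) => hlow I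
  rw [hsum, ← Finset.mul_sum] at hle
  have hpos : (0 : ℝ) < Fintype.card ι := by exact_mod_cast Fintype.card_pos
  have hnn : 0 ≤ ∑ I : ι → α, c I ^ 2 := Finset.sum_nonneg fun _ _ => sq_nonneg _
  have hzero : ∑ I : ι → α, c I ^ 2 = 0 := by nlinarith
  ext I
  have := (Finset.sum_eq_zero_iff_of_nonneg fun I _ => sq_nonneg (c I)).1 hzero I
    (Finset.mem_univ I)
  simpa using this

lemma IsOrthogonalInvariant.reindex {c : (ι → α) → ℝ} (hc : IsOrthogonalInvariant c)
    (e : κ ≃ ι) : IsOrthogonalInvariant fun L : κ → α => c (L ∘ e.symm) := by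
  intro A hA I
  refine Eq.trans ?_ (hc A hA (I ∘ e.symm))
  refine Fintype.sum_equiv (e.arrowCongr (Equiv.refl α)) _ _ fun J => ?_
  congr 1
  exact Fintype.prod_equiv e _ _ fun t => by simp

lemma IsOrthogonalToBrauer.reindex {c : (ι → α) → ℝ} (hc : IsOrthogonalToBrauer c)
    (e : κ ≃ ι) : IsOrthogonalToBrauer fun L : κ → α => c (L ∘ e.symm) := by
  intro σ h2 hne
  refine Eq.trans ?_ (hc ((e.symm.trans σ).trans e) (by simp [h2])
    fun x hx => hne (e.symm x) (e.injective (by simpa using hx)))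
  refine Fintype.sum_equiv (e.arrowCongr (Equiv.refl α)) _ _ fun J => ?_
  have : J ∘ σ = J ↔ (J ∘ e.symm) ∘ ((e.symm.trans σ).trans e) = J ∘ e.symm := by
    constructor
    · intro h
      ext x
      simpa using congrFun h (e.symm x)
    · intro h
      ext x
      simpa using congrFun h (e x)
  exact if_congr this rfl rfl

lemma IsOrthogonalInvariant.contract {c : (κ ⊕ Fin 2 → α) → ℝ} (hc : IsOrthogonalInvariant c) :
    IsOrthogonalInvariant fun J : κ → α => ∑ q, c (Sum.elim J ![q, q]) := by
  intro A hA I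
  have hAA : ∀ p r, ∑ q, A q p * A q r = if p = r then 1 else 0 := by
    intro p r
    have h := congrFun (congrFun ((mem_orthogonalGroup_iff' α ℝ).1 hA) p) r
    simpa [mul_apply, one_apply] using h
  have hq := fun q => hc A hA (Sum.elim I ![q, q])
  simp only [← hq, sum_sumArrow, Fintype.prod_sum_type, Fin.prod_univ_two, Sum.elim_inl,
    Sum.elim_inr, cons_val_zero, cons_val_one]
  rw [Finset.sum_comm]
  refine Finset.sum_congr rfl fun J _ => ?_
  rw [Finset.sum_comm, Finset.mul_sum]
  refine Finset.sum_congr rfl fun p _ => ?_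
  rw [Finset.sum_comm]
  have : ∀ r, ∑ q, (∏ t, A (I t) (J t)) * (A q p * A q r) * c (Sum.elim J ![p, r]) =
      (∏ t, A (I t) (J t)) * (if p = r then c (Sum.elim J ![p, r]) else 0) := by
    intro r
    rw [← Finset.sum_mul, ← Finset.mul_sum, hAA]
    split_ifs <;> simp
  simp [this]

lemma IsOrthogonalToBrauer.contract {c : (κ ⊕ Fin 2 → α) → ℝ} (hc : IsOrthogonalToBrauer c) :
    IsOrthogonalToBrauer fun J : κ → α => ∑ q, c (Sum.elim J ![q, q]) := by
  intro σ h2 hne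
  refine Eq.trans ?_ (hc (Equiv.sumCongr σ (Equiv.swap 0 1))
    (by rintro (x | x) <;> simp [h2]) (by
      rintro (x | x)
      · simpa using hne x
      · fin_cases x <;> simp))
  rw [sum_sumArrow]
  refine Finset.sum_congr rfl fun J _ => ?_
  have : ∀ p q, Sum.elim J ![p, q] ∘ Equiv.sumCongr σ (Equiv.swap 0 1) = Sum.elim J ![p, q] ↔
      J ∘ σ = J ∧ p = q := by
    intro p q
    simp only [funext_iff, Sum.forall, Fin.forall_fin_two]
    simp +contextual [eq_comm]
  simp only [this]
  split_ifs with h <;> simp [h]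

/-- An orthogonally invariant array orthogonal to all Brauer diagrams is zero. -/
theorem IsOrthogonalInvariant.eq_zero_of_isOrthogonalToBrauer [Nonempty α] {c : (ι → α) → ℝ}
    (hc : IsOrthogonalInvariant c) (hB : IsOrthogonalToBrauer c) : c = 0 := by
  induction hm : Fintype.card ι using Nat.strong_induction_on generalizing ι with
  | _ m ih =>
  rcases isEmpty_or_nonempty ι with hι | hι
  · ext I
    have h := hB 1 (fun x => isEmptyElim x) (fun x => isEmptyElim x)
    simpa [Subsingleton.elim I default] using h
  refine hc.eq_zero_of_traceless fun t u htu I => ?_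
  obtain ⟨p, _, e, ht, hu⟩ := exists_sumEquiv_of_ne htu
  have hcard := Fintype.card_congr e
  rw [Fintype.card_sum, Fintype.card_fin] at hcard
  have h0 := congrFun (ih _ (by omega) (hc.reindex e).contract (hB.reindex e).contract rfl)
    (I ∘ e ∘ Sum.inl)
  refine Eq.trans ?_ h0
  refine Finset.sum_congr rfl fun q _ => congrArg c ?_
  ext x
  obtain ⟨y, rfl⟩ := e.surjective x
  subst ht hu
  rcases y with y | y
  · simp
  · fin_cases y <;> simp

lemma isOrthogonalInvariant_ite_inl_eq_inr :
    IsOrthogonalInvariant fun I : κ ⊕ κ → α =>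
      if I ∘ Sum.inl = I ∘ Sum.inr then (1 : ℝ) else 0 := by
  intro A hA I
  have hAA : ∀ i j, ∑ q, A i q * A j q = if i = j then 1 else 0 := by
    intro i j
    have h := congrFun (congrFun ((mem_orthogonalGroup_iff α ℝ).1 hA) i) j
    simpa [mul_apply, one_apply] using h
  rw [← (Equiv.sumArrowEquivProdArrow κ κ α).symm.sum_comp, Fintype.sum_prod_type]
  calc _ = ∑ J : κ → α, ∏ s, A (I (Sum.inl s)) (J s) * A (I (Sum.inr s)) (J s) := by
        refine Finset.sum_congr rfl fun J _ => ?_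
        rw [Finset.sum_eq_single J]
        · simp [Fintype.prod_sum_type, Finset.prod_mul_distrib, Function.comp_def]
        · intro J' _ h
          simp [Function.comp_def, h.symm]
        · simp
    _ = _ := by
        rw [← Fintype.prod_sum fun s q => A (I (Sum.inl s)) q * A (I (Sum.inr s)) q]
        simp [hAA, Fintype.prod_ite_zero, funext_iff]

lemma isOrthogonalInvariant_brauer (σ : Equiv.Perm ι) (h2 : ∀ x, σ (σ x) = x)
    (hne : ∀ x, σ x ≠ x) :
    IsOrthogonalInvariant fun I : ι → α => if I ∘ σ = I then (1 : ℝ) else 0 := by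
  obtain ⟨p, _, f, hf⟩ := exists_sumEquiv_of_involutive σ h2 hne
  convert (isOrthogonalInvariant_ite_inl_eq_inr (κ := {x // p x}) (α := α)).reindex f.symm
    using 3 with I
  simp only [funext_iff, Function.comp_apply, Equiv.symm_symm, hf]
  refine ⟨fun h x => (h _).symm, fun h x => ?_⟩
  obtain ⟨y | y, rfl⟩ := f.surjective x
  · exact (h y).symm
  · rw [hf, h2, h]

end OrthogonalInvariants

open Module in
/-- The coordinates of a tensor in the standard basis, as a Euclidean vector. -/
noncomputable def tensorCoords (n d : ℕ) :
    (⨂[ℝ] _ : Fin d, EuclideanSpace ℝ (Fin n)) ≃ₗ[ℝ] EuclideanSpace ℝ (Fin d → Fin n) :=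
  (Basis.piTensorProduct fun _ : Fin d =>
    (EuclideanSpace.basisFun (Fin n) ℝ).toBasis).equivFun ≪≫ₗ
      (WithLp.linearEquiv 2 ℝ ((Fin d → Fin n) → ℝ)).symm

lemma tensorCoords_tprod (n d : ℕ) (v : Fin d → EuclideanSpace ℝ (Fin n))
    (I : Fin d → Fin n) :
    tensorCoords n d (PiTensorProduct.tprod ℝ v) I = ∏ t, v t (I t) := by
  simp [tensorCoords]

lemma tensorCoords_map (n d : ℕ) (A : Matrix (Fin n) (Fin n) ℝ)
    (x : ⨂[ℝ] _ : Fin d, EuclideanSpace ℝ (Fin n)) (I : Fin d → Fin n) :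
    tensorCoords n d (PiTensorProduct.map (fun _ => Matrix.toEuclideanLin A) x) I =
      ∑ J, (∏ t, A (I t) (J t)) * tensorCoords n d x J := by
  induction x using PiTensorProduct.induction_on with
  | smul_tprod r v =>
    simp only [map_smul, PiTensorProduct.map_tprod, PiLp.smul_apply, tensorCoords_tprod,
      smul_eq_mul]
    simp only [Matrix.toLpLin_apply, Matrix.mulVec, dotProduct, Fintype.prod_sum,
      Finset.prod_mul_distrib, Finset.mul_sum]
    exact Finset.sum_congr rfl fun J _ => by ring
  | add x y hx hy =>
    simp only [map_add, PiLp.add_apply, hx, hy, mul_add, Finset.sum_add_distrib]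

lemma tensorCoords_brauerTensor (n d : ℕ) (σ : Equiv.Perm (Fin d)) (I : Fin d → Fin n) :
    tensorCoords n d (brauerTensor n d σ) I = if I ∘ σ = I then 1 else 0 := by
  simp [brauerTensor, tensorCoords_tprod, Fintype.prod_ite_zero, ← funext_iff,
    Finset.sum_ite_eq, Finset.sum_apply]

lemma isOrthogonalInvariant_tensorCoords_iff {n d : ℕ}
    {x : ⨂[ℝ] _ : Fin d, EuclideanSpace ℝ (Fin n)} :
    IsOrthogonalInvariant (tensorCoords n d x) ↔
      ∀ A ∈ Matrix.orthogonalGroup (Fin n) ℝ,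
        PiTensorProduct.map (fun _ : Fin d => Matrix.toEuclideanLin A) x = x := by
  refine forall₂_congr fun A _ => ?_
  rw [← (tensorCoords n d).injective.eq_iff, PiLp.ext_iff]
  simp only [tensorCoords_map]

theorem stmt_0 (n : ℕ) (hn : 1 ≤ n) (e : ℕ) (he : 1 ≤ e) (d : ℕ) (hd : d = 2 * e) :
    {x : ⨂[ℝ] _ : Fin d, EuclideanSpace ℝ (Fin n) |
        ∀ A ∈ Matrix.orthogonalGroup (Fin n) ℝ,
          PiTensorProduct.map (fun _ : Fin d => (Matrix.toEuclideanLin A :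
            EuclideanSpace ℝ (Fin n) →ₗ[ℝ] EuclideanSpace ℝ (Fin n))) x = x} =
      ↑(Submodule.span ℝ
        {t : ⨂[ℝ] _ : Fin d, EuclideanSpace ℝ (Fin n) |
          ∃ σ : Equiv.Perm (Fin d), IsBrauerDiagram σ ∧ t = brauerTensor n d σ}) := by
  have : NeZero n := ⟨by omega⟩
  set W := Submodule.span ℝ
    {t : ⨂[ℝ] _ : Fin d, EuclideanSpace ℝ (Fin n) |
      ∃ σ : Equiv.Perm (Fin d), IsBrauerDiagram σ ∧ t = brauerTensor n d σ} with hW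
  have hinv : ∀ x ∈ W, ∀ A ∈ Matrix.orthogonalGroup (Fin n) ℝ,
      PiTensorProduct.map (fun _ : Fin d => Matrix.toEuclideanLin A) x = x := by
    intro x hx A hA
    induction hx using Submodule.span_induction with
    | mem x hx =>
      obtain ⟨σ, hσ, rfl⟩ := hx
      refine isOrthogonalInvariant_tensorCoords_iff.1 ?_ A hA
      convert isOrthogonalInvariant_brauer (α := Fin n) σ hσ.1 hσ.2 using 1
      ext I
      exact tensorCoords_brauerTensor n d σ I
    | zero => exact map_zero _
    | add x y _ _ hx hy => rw [map_add, hx, hy]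
    | smul r x _ hx => rw [map_smul, hx]
  refine Set.Subset.antisymm (fun x hx => ?_) hinv
  obtain ⟨w, hw, z, hz, hxz⟩ := Submodule.exists_add_mem_mem_orthogonal
    (K := W.map (tensorCoords n d).toLinearMap) (tensorCoords n d x)
  obtain ⟨w, hw, rfl⟩ := hw
  have hzx : z = tensorCoords n d (x - w) := by
    rw [map_sub, hxz]
    simp
  have hz0 : (z : (Fin d → Fin n) → ℝ) = 0 := by
    refine IsOrthogonalInvariant.eq_zero_of_isOrthogonalToBrauer ?_ fun σ h2 hne => ?_
    · rw [hzx, isOrthogonalInvariant_tensorCoords_iff]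
      intro A hA
      rw [map_sub, hx A hA, hinv w hw A hA]
    · have h := hz _ (Submodule.mem_map_of_mem (f := (tensorCoords n d).toLinearMap)
        (Submodule.subset_span ⟨σ, ⟨h2, hne⟩, rfl⟩))
      simpa [PiLp.inner_apply, tensorCoords_brauerTensor] using h
  have hxw : x - w = 0 := by
    rw [← (tensorCoords n d).map_eq_zero_iff, ← hzx]
    ext I
    exact congrFun hz0 I
  rw [sub_eq_zero.1 hxw]
  exact hw
end

section
/- Let e be a positive integer, let σ be a fixed-point-free involution of Fin (2e), and let n ≥ 1. Then Σ_τ n^{k(σ,τ)} = n(n+2)(n+4)⋯(n+2e−2) = ∏_{j=0}^{e−1} (n+2j), where the sum is over all fixed-point-free involutions τ of Fin (2e), and k(σ,τ) denotes the number of orbits of the subgroup of the permutation group of Fin (2e) generated by σ and τ, acting on Fin (2e). -/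
instance {d : ℕ} : DecidablePred (IsBrauerDiagram (d := d)) := fun σ =>
  inferInstanceAs (Decidable ((∀ x, σ (σ x) = x) ∧ ∀ x, σ x ≠ x))

section ColoredMatchings

variable {V C : Type*} [Fintype V] [DecidableEq V] [DecidableEq C]

/-- The perfect matchings of `S`, as involutions of `V` with support `S`, all of whose pairs are
monochromatic for the coloring `f`. -/
def coloredMatchings (f : V → C) (S : Finset V) : Finset (Equiv.Perm V) :=
  Finset.univ.filter fun τ =>
    (∀ x, τ (τ x) = x) ∧ (∀ x, τ x ≠ x ↔ x ∈ S) ∧ ∀ x, f (τ x) = f x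

theorem mem_coloredMatchings {f : V → C} {S : Finset V} {τ : Equiv.Perm V} :
    τ ∈ coloredMatchings f S ↔
      (∀ x, τ (τ x) = x) ∧ (∀ x, τ x ≠ x ↔ x ∈ S) ∧ ∀ x, f (τ x) = f x := by
  simp [coloredMatchings]

theorem coloredMatchings_congr {f g : V → C} {S : Finset V} (h : ∀ x ∈ S, f x = g x) :
    coloredMatchings f S = coloredMatchings g S := by
  ext τ
  simp only [mem_coloredMatchings]
  refine and_congr_right fun h1 => and_congr_right fun h2 => forall_congr' fun x => ?_
  by_cases hx : x ∈ S
  · have hτx : τ x ∈ S := by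
      rw [← h2, h1]
      exact ((h2 x).2 hx).symm
    rw [h x hx, h _ hτx]
  · have hτx : τ x = x := by
      by_contra h3
      exact hx ((h2 x).1 h3)
    simp [hτx]

theorem card_coloredMatchings_empty (f : V → C) : (coloredMatchings f ∅).card = 1 := by
  rw [Finset.card_eq_one]
  refine ⟨1, ?_⟩
  ext τ
  rw [mem_coloredMatchings, Finset.mem_singleton]
  constructor
  · rintro ⟨-, h, -⟩
    ext x
    simpa using h x
  · rintro rfl
    simp

theorem card_coloredMatchings_apply_eq (f : V → C) (S : Finset V) {a b : V} (ha : a ∈ S)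
    (hb : b ∈ S) (hab : a ≠ b) (hf : f a = f b) :
    ((coloredMatchings f S).filter fun τ => τ a = b).card =
      (coloredMatchings f (S \ {a, b})).card := by
  refine Finset.card_nbij' (fun τ => τ * Equiv.swap a b) (fun τ => τ * Equiv.swap a b) ?_ ?_ ?_ ?_
  · intro τ hτ
    simp only [Finset.coe_filter, Set.mem_ofPred_eq, mem_coloredMatchings] at hτ
    obtain ⟨⟨h1, h2, h3⟩, h4⟩ := hτ
    have h5 : τ b = a := by rw [← h4, h1]
    simp only [Finset.mem_coe, mem_coloredMatchings, Equiv.Perm.mul_apply, Finset.mem_sdiff,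
      Finset.mem_insert, Finset.mem_singleton]
    have key : ∀ x, x ≠ a → x ≠ b → τ x ≠ a ∧ τ x ≠ b := by
      intro x hxa hxb
      refine ⟨fun h => hxb ?_, fun h => hxa ?_⟩
      · rw [← h1 x, h, h4]
      · rw [← h1 x, h, h5]
    refine ⟨fun x => ?_, fun x => ?_, fun x => ?_⟩
    all_goals
      rcases eq_or_ne x a with rfl | hxa
      · simp [h5]
      rcases eq_or_ne x b with rfl | hxb
      · simp [h4]
      rw [Equiv.swap_apply_of_ne_of_ne hxa hxb]
    · rw [Equiv.swap_apply_of_ne_of_ne (key x hxa hxb).1 (key x hxa hxb).2, h1]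
    · simp [h2, hxa, hxb]
    · exact h3 x
  · intro τ hτ
    rw [Finset.mem_coe, mem_coloredMatchings] at hτ
    obtain ⟨h1, h2, h3⟩ := hτ
    have h4 : τ a = a := by simpa using h2 a
    have h5 : τ b = b := by simpa using h2 b
    have key : ∀ x, x ≠ a → x ≠ b → τ x ≠ a ∧ τ x ≠ b := by
      intro x hxa hxb
      refine ⟨fun h => hxa ?_, fun h => hxb ?_⟩
      · rw [← h1 x, h, h4]
      · rw [← h1 x, h, h5]
    simp only [Finset.coe_filter, Set.mem_ofPred_eq, mem_coloredMatchings, Equiv.Perm.mul_apply]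
    refine ⟨⟨fun x => ?_, fun x => ?_, fun x => ?_⟩, by simp [h5]⟩
    all_goals
      rcases eq_or_ne x a with rfl | hxa
      · simp [h4, h5, ha, hf, hab.symm]
      rcases eq_or_ne x b with rfl | hxb
      · simp [h4, h5, hb, hf, hab]
      rw [Equiv.swap_apply_of_ne_of_ne hxa hxb]
    · rw [Equiv.swap_apply_of_ne_of_ne (key x hxa hxb).1 (key x hxa hxb).2, h1]
    · simp [h2, hxa, hxb]
    · exact h3 x
  · intro τ _
    simp [mul_assoc]
  · intro τ _
    simp [mul_assoc]

theorem card_coloredMatchings_apply_le (f : V → C) (S : Finset V) {a x y : V} (hx : x ∈ S)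
    (hy : y ∈ S) (hxa : x ≠ a) (hya : y ≠ a) (hf : f x = f y) :
    ((coloredMatchings f S).filter fun τ => τ a = x).card ≤
      ((coloredMatchings f S).filter fun τ => τ a = y).card := by
  refine Finset.card_le_card_of_injOn
    (fun τ => Equiv.swap x y * τ * Equiv.swap x y) ?_ ?_
  · intro τ hτ
    simp only [Finset.coe_filter, Set.mem_ofPred_eq, mem_coloredMatchings] at hτ
    obtain ⟨⟨h1, h2, h3⟩, h4⟩ := hτ
    have hs : ∀ z, f (Equiv.swap x y z) = f z := by
      intro z
      rw [Equiv.swap_apply_def]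
      split_ifs with h h' <;> simp [*]
    have hS : ∀ z, Equiv.swap x y z ∈ S ↔ z ∈ S := by
      intro z
      rw [Equiv.swap_apply_def]
      split_ifs with h h' <;> simp [*]
    simp only [Finset.coe_filter, Set.mem_ofPred_eq, mem_coloredMatchings, Equiv.Perm.mul_apply]
    refine ⟨⟨fun z => ?_, fun z => ?_, fun z => ?_⟩, ?_⟩
    · simp [h1]
    · rw [← hS z, ← h2, Ne, Ne, Equiv.swap_apply_eq_iff]
    · rw [hs, h3, hs]
    · rw [Equiv.swap_apply_of_ne_of_ne hxa.symm hya.symm, h4, Equiv.swap_apply_left]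
  · intro τ _ τ' _ h
    simpa using h

theorem card_coloredMatchings_eq_mul (f : V → C) (S : Finset V) {a b : V} (ha : a ∈ S)
    (hb : b ∈ S) (hab : a ≠ b) (hf : f a = f b) :
    (coloredMatchings f S).card =
      ((S \ {a, b}).filter (fun x => f x = f a)).card.succ *
        (coloredMatchings f (S \ {a, b})).card := by
  have hmaps : ∀ τ ∈ coloredMatchings f S, τ a ∈ (S.filter fun x => f x = f a).erase a := by
    intro τ hτ
    obtain ⟨h1, h2, h3⟩ := mem_coloredMatchings.1 hτ
    simp only [Finset.mem_erase, Finset.mem_filter]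
    refine ⟨(h2 a).2 ha, ?_, h3 a⟩
    rw [← h2, h1]
    exact ((h2 a).2 ha).symm
  rw [Finset.card_eq_sum_card_fiberwise hmaps]
  have hconst : ∀ x ∈ (S.filter fun x => f x = f a).erase a,
      ((coloredMatchings f S).filter fun τ => τ a = x).card =
        (coloredMatchings f (S \ {a, b})).card := by
    intro x hx
    simp only [Finset.mem_erase, Finset.mem_filter] at hx
    obtain ⟨hxa, hxS, hfx⟩ := hx
    rw [← card_coloredMatchings_apply_eq f S ha hb hab hf]
    exact le_antisymm
      (card_coloredMatchings_apply_le f S hxS hb hxa hab.symm (hfx.trans hf))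
      (card_coloredMatchings_apply_le f S hb hxS hab.symm hxa (hfx.trans hf).symm)
  rw [Finset.sum_congr rfl hconst, Finset.sum_const, smul_eq_mul]
  congr 1
  have : (S.filter fun x => f x = f a).erase a =
      insert b ((S \ {a, b}).filter fun x => f x = f a) := by
    ext x
    simp only [Finset.mem_erase, Finset.mem_filter, Finset.mem_insert, Finset.mem_sdiff,
      Finset.mem_singleton]
    rcases eq_or_ne x b with rfl | hxb
    · simp [hab.symm, hb, hf]
    · simp only [hxb, or_false, false_or]
      tauto
  rw [this, Finset.card_insert_of_notMem (by simp)]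

end ColoredMatchings

section InvariantColorings

variable {V : Type*} [Fintype V] [DecidableEq V]

/-- The `σ`-invariant colorings of `V` which take the default color `0` outside `S`. -/
def invariantColorings (σ : Equiv.Perm V) (n : ℕ) [NeZero n] (S : Finset V) :
    Finset (V → Fin n) :=
  Finset.univ.filter fun f => (∀ x, f (σ x) = f x) ∧ ∀ x, x ∉ S → f x = 0

theorem mem_invariantColorings {σ : Equiv.Perm V} {n : ℕ} [NeZero n] {S : Finset V}
    {f : V → Fin n} :
    f ∈ invariantColorings σ n S ↔ (∀ x, f (σ x) = f x) ∧ ∀ x, x ∉ S → f x = 0 := by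
  simp [invariantColorings]

theorem sum_invariantColorings_eq {σ : Equiv.Perm V} (hσ : ∀ x, σ (σ x) = x) {n : ℕ} [NeZero n]
    {S : Finset V} {a : V} (ha : a ∈ S) (hσa : σ a ∈ S) (g : (V → Fin n) → ℕ) :
    ∑ f ∈ invariantColorings σ n S, g f =
      ∑ f ∈ invariantColorings σ n (S \ {a, σ a}), ∑ c : Fin n,
        g fun x => if x = a ∨ x = σ a then c else f x := by
  have hiff : ∀ x, (σ x = a ∨ σ x = σ a) ↔ (x = a ∨ x = σ a) := by
    intro x
    have : σ x = a ↔ x = σ a := ⟨fun h => by rw [← h, hσ], fun h => by rw [h, hσ]⟩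
    rw [this, σ.injective.eq_iff, or_comm]
  rw [← Finset.sum_product']
  refine Finset.sum_nbij' (fun f => (fun x => if x = a ∨ x = σ a then 0 else f x, f a))
    (fun p x => if x = a ∨ x = σ a then p.2 else p.1 x) ?_ ?_ ?_ ?_ ?_
  · intro f hf
    obtain ⟨h1, h2⟩ := mem_invariantColorings.1 hf
    simp only [Finset.mem_product, Finset.mem_univ, and_true, mem_invariantColorings]
    refine ⟨fun x => by simp only [hiff, h1], fun x hx => ?_⟩
    split_ifs with h
    · rfl
    · exact h2 x fun hxS => hx (by simpa [hxS] using h)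
  · rintro ⟨f, c⟩ hf
    simp only [Finset.mem_product, Finset.mem_univ, and_true, mem_invariantColorings] at hf
    obtain ⟨h1, h2⟩ := hf
    rw [mem_invariantColorings]
    refine ⟨fun x => by simp only [hiff, h1], fun x hx => ?_⟩
    have hn : ¬(x = a ∨ x = σ a) := by
      rintro (rfl | rfl) <;> contradiction
    simp only [hn, if_false]
    exact h2 x (by simp [hx])
  · intro f hf
    obtain ⟨h1, -⟩ := mem_invariantColorings.1 hf
    funext x
    by_cases h : x = a ∨ x = σ a
    · rcases h with rfl | rfl <;> simp [h1]
    · simp [h]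
  · rintro ⟨f, c⟩ hf
    simp only [Finset.mem_product, Finset.mem_univ, and_true, mem_invariantColorings] at hf
    refine Prod.ext (funext fun x => ?_) (by simp)
    by_cases h : x = a ∨ x = σ a
    · have h0 : f x = 0 := hf.2 x (by simp [h])
      simp [h, h0]
    · simp [h]
  · intro f hf
    obtain ⟨h1, -⟩ := mem_invariantColorings.1 hf
    congr 1
    funext x
    by_cases h : x = a ∨ x = σ a
    · rcases h with rfl | rfl <;> simp [h1]
    · simp [h]

theorem sum_card_coloredMatchings {σ : Equiv.Perm V} (hσ : ∀ x, σ (σ x) = x)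
    (hσ' : ∀ x, σ x ≠ x) (n : ℕ) [NeZero n] (m : ℕ) (S : Finset V) (hS : S.card = 2 * m)
    (hσS : ∀ x ∈ S, σ x ∈ S) :
    ∑ f ∈ invariantColorings σ n S, (coloredMatchings f S).card =
      ∏ j ∈ Finset.range m, (n + 2 * j) := by
  induction m generalizing S with
  | zero =>
    obtain rfl : S = ∅ := by simpa using hS
    have : invariantColorings σ n (∅ : Finset V) = {0} := by
      ext f
      rw [mem_invariantColorings, Finset.mem_singleton]
      constructor
      · rintro ⟨-, h⟩
        funext x
        exact h x (by simp)
      · rintro rfl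
        simp
    simp [this, card_coloredMatchings_empty]
  | succ m ih =>
    obtain ⟨a, ha⟩ : S.Nonempty := by
      rw [← Finset.card_pos]
      omega
    have hσa := hσS a ha
    have hsub : ({a, σ a} : Finset V) ⊆ S := by
      simp [Finset.insert_subset_iff, ha, hσa]
    have hcard : (S \ {a, σ a}).card = 2 * m := by
      rw [Finset.card_sdiff_of_subset hsub, Finset.card_pair (hσ' a).symm]
      omega
    have hinv : ∀ x ∈ S \ {a, σ a}, σ x ∈ S \ {a, σ a} := by
      intro x hx
      simp only [Finset.mem_sdiff, Finset.mem_insert, Finset.mem_singleton, not_or] at hx ⊢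
      refine ⟨hσS x hx.1, fun h => hx.2.2 ?_, fun h => hx.2.1 (σ.injective h)⟩
      rw [← h, hσ]
    rw [sum_invariantColorings_eq hσ ha hσa, Finset.prod_range_succ, ← ih _ hcard hinv,
      Finset.sum_mul]
    refine Finset.sum_congr rfl fun f _ => ?_
    have hterm : ∀ c : Fin n,
        (coloredMatchings (fun x => if x = a ∨ x = σ a then c else f x) S).card =
          (((S \ {a, σ a}).filter fun x => f x = c).card + 1) *
            (coloredMatchings f (S \ {a, σ a})).card := by
      intro c
      have hagree : ∀ x ∈ S \ {a, σ a}, (if x = a ∨ x = σ a then c else f x) = f x := by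
        intro x hx
        simp only [Finset.mem_sdiff, Finset.mem_insert, Finset.mem_singleton] at hx
        rw [if_neg hx.2]
      rw [card_coloredMatchings_eq_mul _ S ha hσa (hσ' a).symm (by simp),
        coloredMatchings_congr hagree]
      congr 3
      refine Finset.filter_congr fun x hx => ?_
      rw [hagree x hx]
      simp
    rw [Finset.sum_congr rfl fun c _ => hterm c, ← Finset.sum_mul, Finset.sum_add_distrib,
      ← Finset.card_eq_sum_card_fiberwise (fun x _ => Finset.mem_coe.2 (Finset.mem_univ (f x))),
      hcard]
    simp [mul_comm, add_comm]

end InvariantColorings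

theorem pow_card_orbitRel_quotient_closure {V : Type*} [Fintype V] [DecidableEq V]
    (σ τ : Equiv.Perm V) (n : ℕ) :
    n ^ Nat.card (MulAction.orbitRel.Quotient
        (↥(Subgroup.closure {σ, τ} : Subgroup (Equiv.Perm V))) V) =
      (Finset.univ.filter fun f : V → Fin n =>
        (∀ x, f (σ x) = f x) ∧ ∀ x, f (τ x) = f x).card := by
  set G : Subgroup (Equiv.Perm V) := Subgroup.closure {σ, τ} with hG
  have hlift : ∀ f : V → Fin n, (∀ x, f (σ x) = f x) → (∀ x, f (τ x) = f x) →
      ∀ x y, MulAction.orbitRel G V x y → f x = f y := by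
    rintro f h1 h2 x y ⟨⟨g, hg⟩, rfl⟩
    change f (g y) = f y
    induction hg using Subgroup.closure_induction generalizing y with
    | mem g hg =>
      rcases hg with rfl | rfl
      exacts [h1 y, h2 y]
    | one => rfl
    | mul g h _ _ ihg ihh => rw [Equiv.Perm.mul_apply, ihg, ihh]
    | inv g _ ih => rw [← ih]; simp
  have hmk : ∀ g ∈ G, ∀ x : V, (Quotient.mk (MulAction.orbitRel G V) (g x)) =
      Quotient.mk (MulAction.orbitRel G V) x := fun g hg x =>
    Quotient.sound ⟨⟨g, hg⟩, rfl⟩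
  have hσ : σ ∈ G := Subgroup.subset_closure (by simp)
  have hτ : τ ∈ G := Subgroup.subset_closure (by simp)
  let E : (MulAction.orbitRel.Quotient G V → Fin n) ≃
      {f : V → Fin n // (∀ x, f (σ x) = f x) ∧ ∀ x, f (τ x) = f x} :=
    { toFun := fun F => ⟨fun x => F (Quotient.mk _ x),
        fun x => congrArg F (hmk σ hσ x), fun x => congrArg F (hmk τ hτ x)⟩
      invFun := fun f => Quotient.lift f.1 (hlift f.1 f.2.1 f.2.2)
      left_inv := fun F => by
        funext q
        induction q using Quotient.inductionOn with
        | h x => rfl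
      right_inv := fun f => rfl }
  have h := Nat.card_congr E
  rw [Nat.card_fun, Nat.card_fin] at h
  rw [h, Nat.card_eq_fintype_card, Fintype.card_subtype]

theorem stmt_4 (e : ℕ) (he : 1 ≤ e) (σ : Equiv.Perm (Fin (2 * e)))
    (hσ : IsBrauerDiagram σ) (n : ℕ) (hn : 1 ≤ n) :
    ∑ τ ∈ Finset.univ.filter (fun τ : Equiv.Perm (Fin (2 * e)) => IsBrauerDiagram τ),
        n ^ Nat.card (MulAction.orbitRel.Quotient
          (↥(Subgroup.closure {σ, τ} : Subgroup (Equiv.Perm (Fin (2 * e))))) (Fin (2 * e))) =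
      ∏ j ∈ Finset.range e, (n + 2 * j) := by
  have : NeZero n := ⟨by omega⟩
  rw [← sum_card_coloredMatchings hσ.1 hσ.2 n e Finset.univ (by simp) (by simp)]
  simp only [pow_card_orbitRel_quotient_closure, Finset.card_eq_sum_ones]
  refine Finset.sum_comm' fun τ f => ?_
  simp only [Finset.mem_filter, Finset.mem_univ, true_and, mem_coloredMatchings,
    mem_invariantColorings, not_true_eq_false, false_imp_iff, implies_true,
    and_true, iff_true]
  unfold IsBrauerDiagram
  tauto
end

section
/- Let n ≥ 1, let e be a positive integer, and let μ be the uniform (rotation-invariant) probability measure on the unit sphere S^{n−1} ⊂ EuclideanSpace ℝ (Fin n). For every function i : Fin (2e) → Fin n, ∫_{S^{n−1}} ∏_{t=1}^{2e} v(i(t)) dμ(v) = N(i) / (n(n+2)(n+4)⋯(n+2e−2)), where N(i) is the number of fixed-point-free involutions σ of Fin (2e) such that i∘σ = i. -/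
open MeasureTheory

/-- The matrix of the rotation by the angle `θ` in the coordinate plane spanned by `p` and `q`. -/
noncomputable def planeRotation {n : ℕ} (p q : Fin n) (θ : ℝ) : Matrix (Fin n) (Fin n) ℝ :=
  fun k =>
    if k = p then Real.cos θ • Pi.single p 1 - Real.sin θ • Pi.single q 1
    else if k = q then Real.sin θ • Pi.single p 1 + Real.cos θ • Pi.single q 1
    else Pi.single k 1

/-- The coordinates of the rotation of `v` by the angle `θ` in the `(p, q)`-plane. -/
noncomputable def rotatedCoord {n : ℕ} (p q : Fin n) (v : EuclideanSpace ℝ (Fin n)) (θ : ℝ)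
    (k : Fin n) : ℝ :=
  if k = p then Real.cos θ * v p - Real.sin θ * v q
  else if k = q then Real.sin θ * v p + Real.cos θ * v q
  else v k

/-- The derivative at `θ` of the coordinates of a vector rotated in the `(p, q)`-plane. -/
noncomputable def rotatedCoordDeriv {n : ℕ} (p q : Fin n) (v : EuclideanSpace ℝ (Fin n)) (θ : ℝ)
    (k : Fin n) : ℝ :=
  if k = p then -(Real.sin θ * v p) - Real.cos θ * v q
  else if k = q then Real.cos θ * v p - Real.sin θ * v q
  else 0

theorem planeRotation_mem_orthogonalGroup {n : ℕ} {p q : Fin n} (hpq : p ≠ q) (θ : ℝ) :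
    planeRotation p q θ ∈ Matrix.orthogonalGroup (Fin n) ℝ := by
  rw [Matrix.mem_orthogonalGroup_iff]
  ext j k
  rw [Matrix.mul_apply']
  change planeRotation p q θ j ⬝ᵥ planeRotation p q θ k = _
  unfold planeRotation
  by_cases hjp : j = p <;> by_cases hjq : j = q <;> by_cases hkp : k = p <;>
    by_cases hkq : k = q <;> by_cases hjk : j = k <;>
    simp_all [dotProduct_sub, Matrix.one_apply, eq_comm] <;>
    linarith [Real.sin_sq_add_cos_sq θ]

theorem toEuclideanLin_planeRotation_apply {n : ℕ} (p q : Fin n) (θ : ℝ)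
    (v : EuclideanSpace ℝ (Fin n)) (k : Fin n) :
    (Matrix.toEuclideanLin (planeRotation p q θ) v) k = rotatedCoord p q v θ k := by
  rw [Matrix.toLpLin_apply]
  change planeRotation p q θ k ⬝ᵥ v.ofLp = _
  unfold planeRotation rotatedCoord
  split_ifs <;> simp [sub_dotProduct, add_dotProduct]

theorem hasDerivAt_rotatedCoord {n : ℕ} (p q : Fin n) (v : EuclideanSpace ℝ (Fin n)) (θ : ℝ)
    (k : Fin n) :
    HasDerivAt (fun θ => rotatedCoord p q v θ k) (rotatedCoordDeriv p q v θ k) θ := by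
  unfold rotatedCoord rotatedCoordDeriv
  split_ifs
  · simpa using ((Real.hasDerivAt_cos θ).mul_const (v p)).fun_sub
      ((Real.hasDerivAt_sin θ).mul_const (v q))
  · simpa [sub_eq_add_neg] using ((Real.hasDerivAt_sin θ).mul_const (v p)).fun_add
      ((Real.hasDerivAt_cos θ).mul_const (v q))
  · exact hasDerivAt_const _ _

theorem continuous_rotatedCoord {n : ℕ} (p q : Fin n) (θ : ℝ) (k : Fin n) :
    Continuous fun v => rotatedCoord p q v θ k := by
  unfold rotatedCoord
  split_ifs <;> fun_prop

theorem continuous_rotatedCoordDeriv {n : ℕ} (p q : Fin n) (θ : ℝ) (k : Fin n) :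
    Continuous fun v => rotatedCoordDeriv p q v θ k := by
  unfold rotatedCoordDeriv
  split_ifs <;> fun_prop

theorem abs_mul_le_one {c x : ℝ} (hc : |c| ≤ 1) (hx : |x| ≤ 1) : |c * x| ≤ 1 := by
  rw [abs_mul]
  exact mul_le_one₀ hc (abs_nonneg x) hx

theorem abs_coord_le_one {n : ℕ} {v : EuclideanSpace ℝ (Fin n)} (hv : ‖v‖ = 1) (k : Fin n) :
    |v k| ≤ 1 := by
  simpa [hv] using PiLp.norm_apply_le v k

theorem abs_rotatedCoord_le {n : ℕ} (p q : Fin n) {v : EuclideanSpace ℝ (Fin n)} (hv : ‖v‖ = 1)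
    (θ : ℝ) (k : Fin n) : |rotatedCoord p q v θ k| ≤ 2 := by
  have h := fun k => abs_coord_le_one hv k
  have h1 := fun k => abs_le.mp (abs_mul_le_one (Real.abs_cos_le_one θ) (h k))
  have h2 := fun k => abs_le.mp (abs_mul_le_one (Real.abs_sin_le_one θ) (h k))
  have := h1 p; have := h1 q; have := h2 p; have := h2 q; have := abs_le.mp (h k)
  unfold rotatedCoord
  rw [abs_le]
  split_ifs <;> constructor <;> linarith

theorem abs_rotatedCoordDeriv_le {n : ℕ} (p q : Fin n) {v : EuclideanSpace ℝ (Fin n)}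
    (hv : ‖v‖ = 1) (θ : ℝ) (k : Fin n) : |rotatedCoordDeriv p q v θ k| ≤ 2 := by
  have h := fun k => abs_coord_le_one hv k
  have h1 := fun k => abs_le.mp (abs_mul_le_one (Real.abs_cos_le_one θ) (h k))
  have h2 := fun k => abs_le.mp (abs_mul_le_one (Real.abs_sin_le_one θ) (h k))
  have := h1 p; have := h1 q; have := h2 p; have := h2 q
  unfold rotatedCoordDeriv
  rw [abs_le]
  split_ifs <;> constructor <;> linarith

theorem ae_norm_eq_one {n : ℕ} (μ : Measure (EuclideanSpace ℝ (Fin n))) [IsProbabilityMeasure μ]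
    (hsphere : μ (Metric.sphere (0 : EuclideanSpace ℝ (Fin n)) 1) = 1) :
    ∀ᵐ v ∂μ, ‖v‖ = 1 := by
  have h := (prob_compl_eq_zero_iff (μ := μ) Metric.isClosed_sphere.measurableSet).mpr hsphere
  filter_upwards [compl_mem_ae_iff.mpr h] with v hv
  simpa using hv

theorem integrable_of_continuous_of_sphere {n : ℕ} (μ : Measure (EuclideanSpace ℝ (Fin n)))
    [IsProbabilityMeasure μ]
    (hsphere : μ (Metric.sphere (0 : EuclideanSpace ℝ (Fin n)) 1) = 1)
    {f : EuclideanSpace ℝ (Fin n) → ℝ} (hf : Continuous f) : Integrable f μ := by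
  obtain ⟨C, hC⟩ := (isCompact_sphere (0 : EuclideanSpace ℝ (Fin n)) 1).exists_bound_of_continuousOn
    hf.continuousOn
  refine Integrable.of_bound hf.aestronglyMeasurable C ?_
  filter_upwards [ae_norm_eq_one μ hsphere] with v hv
  exact hC v (by simpa using hv)

/-- Infinitesimal rotation invariance, applied to the monomial `∏ t ∈ T, v (i t)`. -/
theorem integral_infinitesimal_rotation {n : ℕ} {ι : Type*} [DecidableEq ι]
    (μ : Measure (EuclideanSpace ℝ (Fin n))) [IsProbabilityMeasure μ]
    (hsphere : μ (Metric.sphere (0 : EuclideanSpace ℝ (Fin n)) 1) = 1)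
    (hinv : ∀ A ∈ Matrix.orthogonalGroup (Fin n) ℝ,
      μ.map (⇑(Matrix.toEuclideanLin A :
        EuclideanSpace ℝ (Fin n) →ₗ[ℝ] EuclideanSpace ℝ (Fin n))) = μ)
    {p q : Fin n} (hpq : p ≠ q) (i : ι → Fin n) (T : Finset ι) :
    ∫ v, ∑ t ∈ T, (∏ s ∈ T.erase t, v (i s)) *
      (if i t = p then -v q else if i t = q then v p else 0) ∂μ = 0 := by
  set F : ℝ → EuclideanSpace ℝ (Fin n) → ℝ := fun θ v => ∏ t ∈ T, rotatedCoord p q v θ (i t)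
  set F' : ℝ → EuclideanSpace ℝ (Fin n) → ℝ := fun θ v =>
    ∑ t ∈ T, (∏ s ∈ T.erase t, rotatedCoord p q v θ (i s)) * rotatedCoordDeriv p q v θ (i t)
  have hFc : ∀ θ, Continuous (F θ) := fun θ =>
    continuous_finsetProd _ fun t _ => continuous_rotatedCoord p q θ (i t)
  have hF'c : ∀ θ, Continuous (F' θ) := fun θ =>
    continuous_finsetSum _ fun t _ => (continuous_finsetProd _ fun s _ =>
      continuous_rotatedCoord p q θ (i s)).mul (continuous_rotatedCoordDeriv p q θ (i t))
  have hderiv := (hasDerivAt_integral_of_dominated_loc_of_deriv_le (μ := μ) (F := F) (F' := F')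
    (x₀ := 0) (bound := fun _ => ∑ t ∈ T, (∏ s ∈ T.erase t, (2 : ℝ)) * 2) Filter.univ_mem
    (Filter.Eventually.of_forall fun θ => (hFc θ).aestronglyMeasurable)
    (integrable_of_continuous_of_sphere μ hsphere (hFc 0)) (hF'c 0).aestronglyMeasurable
    (by
      filter_upwards [ae_norm_eq_one μ hsphere] with v hv θ _
      refine (norm_sum_le _ _).trans (Finset.sum_le_sum fun t _ => ?_)
      rw [norm_mul, norm_prod]
      exact mul_le_mul (Finset.prod_le_prod (fun _ _ => norm_nonneg _)
        fun s _ => abs_rotatedCoord_le p q hv θ (i s)) (abs_rotatedCoordDeriv_le p q hv θ (i t))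
        (norm_nonneg _) (by positivity))
    (integrable_const _)
    (Filter.Eventually.of_forall fun v θ _ => by
      simpa using HasDerivAt.fun_finsetProd (u := T)
        fun t _ => hasDerivAt_rotatedCoord p q v θ (i t))).2
  have hconst : ∀ θ, ∫ v, F θ v ∂μ = ∫ v, ∏ t ∈ T, v (i t) ∂μ := fun θ => by
    conv_rhs => rw [← hinv _ (planeRotation_mem_orthogonalGroup hpq θ)]
    rw [integral_map (LinearMap.continuous_of_finiteDimensional _).aemeasurable
      (Continuous.aestronglyMeasurable (by fun_prop))]
    simp only [toEuclideanLin_planeRotation_apply, F]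
  simp only [hconst] at hderiv
  have h0 := hderiv.unique (hasDerivAt_const _ _)
  refine Eq.trans ?_ h0
  refine integral_congr_ae (Filter.Eventually.of_forall fun v => ?_)
  have hcoord : ∀ k, rotatedCoord p q v 0 k = v k := fun k => by
    unfold rotatedCoord
    split_ifs <;> simp_all
  simp [F', hcoord, rotatedCoordDeriv]

/-- Integration by parts on the sphere for monomials. -/
theorem integral_monomial_recursion {n : ℕ} {ι : Type*} [DecidableEq ι]
    (μ : Measure (EuclideanSpace ℝ (Fin n))) [IsProbabilityMeasure μ]
    (hsphere : μ (Metric.sphere (0 : EuclideanSpace ℝ (Fin n)) 1) = 1)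
    (hinv : ∀ A ∈ Matrix.orthogonalGroup (Fin n) ℝ,
      μ.map (⇑(Matrix.toEuclideanLin A :
        EuclideanSpace ℝ (Fin n) →ₗ[ℝ] EuclideanSpace ℝ (Fin n))) = μ)
    (p : Fin n) (i : ι → Fin n) (T : Finset ι) :
    ((n : ℝ) - 1 + T.card) * ∫ v, v p * ∏ t ∈ T, v (i t) ∂μ =
      ∑ t ∈ T with i t = p, ∫ v, ∏ s ∈ T.erase t, v (i s) ∂μ := by
  set D : Fin n → EuclideanSpace ℝ (Fin n) → ℝ := fun q v =>
    v p * ∏ t ∈ T, v (i t) + v q * ∑ t ∈ T, (∏ s ∈ T.erase t, v (i s)) *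
      (if i t = p then -v q else if i t = q then v p else 0)
  have hDc : ∀ q, Continuous (D q) := fun q => by
    refine Continuous.add (by fun_prop) (Continuous.mul (by fun_prop)
      (continuous_finsetSum _ fun t _ => Continuous.mul (by fun_prop) ?_))
    split_ifs <;> fun_prop
  have hD : ∀ q ∈ Finset.univ.erase p, ∫ v, D q v ∂μ = 0 := fun q hq => by
    have hpq : p ≠ q := (Finset.ne_of_mem_erase hq).symm
    rw [← integral_infinitesimal_rotation μ hsphere hinv hpq
      (fun o : Option ι => o.elim q i) (Finset.insertNone T)]
    refine integral_congr_ae (Filter.Eventually.of_forall fun v => ?_)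
    have hnone : (Finset.insertNone T).erase none = T.map Function.Embedding.some := by
      ext o; cases o <;> simp
    have hsome : ∀ t, (Finset.insertNone T).erase (some t) = Finset.insertNone (T.erase t) := by
      intro t; ext o; cases o <;> simp
    simp only [D, Finset.sum_insertNone, hnone, hsome, Finset.prod_insertNone, Finset.prod_map,
      Option.elim, Function.Embedding.some_apply, hpq.symm, if_true, if_false, Finset.mul_sum]
    rw [mul_comm (v p)]
    simp only [mul_assoc]
    rfl
  have hsum : ∫ v, ∑ q ∈ Finset.univ.erase p, D q v ∂μ = 0 := by
    rw [integral_finsetSum _ fun q _ => integrable_of_continuous_of_sphere μ hsphere (hDc q)]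
    exact Finset.sum_eq_zero hD
  have hpoint : ∀ v : EuclideanSpace ℝ (Fin n), ‖v‖ = 1 → ∑ q ∈ Finset.univ.erase p, D q v =
      ((n : ℝ) - 1 + T.card) * (v p * ∏ t ∈ T, v (i t)) -
        ∑ t ∈ T with i t = p, ∏ s ∈ T.erase t, v (i s) := fun v hv => by
    have hn : (((Finset.univ.erase p).card : ℕ) : ℝ) = (n : ℝ) - 1 := by
      rw [Finset.card_erase_of_mem (Finset.mem_univ p), Nat.cast_sub (by simp; have := p.pos; lia)]
      simp
    have hnorm : ∑ q ∈ Finset.univ.erase p, v q * v q = 1 - v p * v p := by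
      have h := EuclideanSpace.real_norm_sq_eq v
      rw [hv, ← Finset.add_sum_erase _ _ (Finset.mem_univ p)] at h
      simp only [pow_two] at h
      linarith
    have hin : ∀ t, ∑ q ∈ Finset.univ.erase p,
        v q * (if i t = p then -v q else if i t = q then v p else 0) =
        v p * v (i t) - if i t = p then 1 else 0 := fun t => by
      by_cases h : i t = p
      · simp only [h, if_true, mul_neg, Finset.sum_neg_distrib, hnorm]
        ring
      · simp [h, mul_comm]
    simp only [D, Finset.sum_add_distrib, Finset.sum_const, nsmul_eq_mul, hn, Finset.mul_sum]
    rw [Finset.sum_comm, add_mul, add_sub_assoc, ← nsmul_eq_mul T.card, ← Finset.sum_const,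
      Finset.sum_filter, ← Finset.sum_sub_distrib]
    congr 1
    refine Finset.sum_congr rfl fun t ht => ?_
    rw [← Finset.mul_prod_erase T (fun t => v (i t)) ht]
    have := hin t
    simp only [mul_left_comm (v _) (∏ s ∈ T.erase t, v (i s)), ← Finset.mul_sum, this]
    split_ifs <;> ring
  rw [integral_congr_ae ((ae_norm_eq_one μ hsphere).mono hpoint), integral_sub
    (integrable_of_continuous_of_sphere μ hsphere (by fun_prop))
    (integrable_of_continuous_of_sphere μ hsphere (by fun_prop)), integral_const_mul,
    integral_finsetSum _ fun t _ => integrable_of_continuous_of_sphere μ hsphere (by fun_prop)]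
    at hsum
  linarith

section Matchings

variable {ι κ : Type*} [Fintype ι] [DecidableEq ι] [DecidableEq κ]

/-- The involutions with support exactly `S` that preserve the labelling `i`. -/
def labelledMatchings (i : ι → κ) (S : Finset ι) : Finset (Equiv.Perm ι) :=
  {σ | (∀ x, σ (σ x) = x) ∧ (∀ x, σ x ≠ x ↔ x ∈ S) ∧ ∀ x, i (σ x) = i x}

theorem mem_labelledMatchings {i : ι → κ} {S : Finset ι} {σ : Equiv.Perm ι} :
    σ ∈ labelledMatchings i S ↔
      (∀ x, σ (σ x) = x) ∧ (∀ x, σ x ≠ x ↔ x ∈ S) ∧ ∀ x, i (σ x) = i x := by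
  simp [labelledMatchings]

theorem labelledMatchings_empty (i : ι → κ) : labelledMatchings i ∅ = {1} := by
  ext σ
  rw [mem_labelledMatchings, Finset.mem_singleton, Equiv.Perm.ext_iff]
  refine ⟨fun h x => by simpa using h.2.1 x, fun h => ?_⟩
  simp_all

theorem swap_mul_mem_labelledMatchings {i : ι → κ} {S : Finset ι} {a t : ι} {σ : Equiv.Perm ι}
    (hσ : σ ∈ labelledMatchings i S) (hat : σ a = t) :
    Equiv.swap a t * σ ∈ labelledMatchings i ((S.erase a).erase t) := by
  rw [mem_labelledMatchings] at hσ ⊢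
  obtain ⟨h1, h2, h3⟩ := hσ
  have hta : σ t = a := by rw [← hat, h1]
  have key : ∀ x, (Equiv.swap a t * σ) x = if x = a ∨ x = t then x else σ x := by
    intro x
    have := h1 x
    simp only [Equiv.Perm.mul_apply, Equiv.swap_apply_def]
    grind
  simp only [key]
  refine ⟨fun x => ?_, fun x => ?_, fun x => ?_⟩
  · grind
  · have := h2 x
    simp only [Finset.mem_erase]
    grind
  · grind

theorem swap_mul_mem_labelledMatchings_of_erase {i : ι → κ} {S : Finset ι} {a t : ι}
    {σ : Equiv.Perm ι} (ha : a ∈ S) (ht : t ∈ S) (hne : t ≠ a) (hi : i t = i a)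
    (hσ : σ ∈ labelledMatchings i ((S.erase a).erase t)) :
    Equiv.swap a t * σ ∈ labelledMatchings i S ∧ (Equiv.swap a t * σ) a = t := by
  rw [mem_labelledMatchings] at hσ ⊢
  obtain ⟨h1, h2, h3⟩ := hσ
  have haa : σ a = a := by simpa using h2 a
  have htt : σ t = t := by simpa using h2 t
  have key : ∀ x, (Equiv.swap a t * σ) x = if x = a then t else if x = t then a else σ x := by
    intro x
    have := h1 x
    simp only [Equiv.Perm.mul_apply, Equiv.swap_apply_def]
    grind
  simp only [key]
  refine ⟨⟨fun x => ?_, fun x => ?_, fun x => ?_⟩, by simp⟩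
  · grind
  · have := h2 x
    simp only [Finset.mem_erase] at this
    grind
  · grind

theorem card_labelledMatchings {i : ι → κ} {S : Finset ι} {a : ι} (ha : a ∈ S) :
    (labelledMatchings i S).card =
      ∑ t ∈ S.erase a with i t = i a, (labelledMatchings i ((S.erase a).erase t)).card := by
  rw [Finset.card_eq_sum_card_fiberwise (f := fun σ => σ a)
    (t := {t ∈ S.erase a | i t = i a})]
  · refine Finset.sum_congr rfl fun t ht => ?_
    simp only [Finset.mem_filter, Finset.mem_erase] at ht
    obtain ⟨⟨hne, htS⟩, hi⟩ := ht
    refine Finset.card_bij' (fun σ _ => Equiv.swap a t * σ) (fun σ _ => Equiv.swap a t * σ)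
      (fun σ hσ => ?_) (fun σ hσ => ?_) (fun σ _ => by simp) (fun σ _ => by simp)
    · rw [Finset.mem_filter] at hσ
      exact swap_mul_mem_labelledMatchings hσ.1 hσ.2
    · rw [Finset.mem_filter]
      exact swap_mul_mem_labelledMatchings_of_erase ha htS hne hi hσ
  · intro σ hσ
    obtain ⟨h1, h2, h3⟩ := mem_labelledMatchings.mp (Finset.mem_coe.mp hσ)
    have h4 := (h2 a).mpr ha
    simp only [Finset.coe_filter, Set.mem_ofPred_eq, Finset.mem_erase]
    exact ⟨⟨h4, (h2 _).mp fun h => h4 (σ.injective h)⟩, h3 a⟩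

end Matchings

theorem integral_monomial_eq_card_labelledMatchings {n : ℕ} {ι : Type*} [Fintype ι]
    [DecidableEq ι] (μ : Measure (EuclideanSpace ℝ (Fin n))) [IsProbabilityMeasure μ]
    (hsphere : μ (Metric.sphere (0 : EuclideanSpace ℝ (Fin n)) 1) = 1)
    (hinv : ∀ A ∈ Matrix.orthogonalGroup (Fin n) ℝ,
      μ.map (⇑(Matrix.toEuclideanLin A :
        EuclideanSpace ℝ (Fin n) →ₗ[ℝ] EuclideanSpace ℝ (Fin n))) = μ)
    (i : ι → Fin n) (e : ℕ) (S : Finset ι) (hS : S.card = 2 * e) :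
    ∫ v, ∏ t ∈ S, v (i t) ∂μ =
      ((labelledMatchings i S).card : ℝ) / ∏ j ∈ Finset.range e, ((n : ℝ) + 2 * j) := by
  induction e generalizing S with
  | zero =>
    obtain rfl : S = ∅ := by simpa using hS
    simp [labelledMatchings_empty]
  | succ e ih =>
    obtain ⟨a, ha⟩ : S.Nonempty := Finset.card_pos.mp (by lia)
    have hcard : (S.erase a).card = 2 * e + 1 := by
      rw [Finset.card_erase_of_mem ha]; lia
    have hrec := integral_monomial_recursion μ hsphere hinv (i a) i (S.erase a)
    have hprod : ∀ v : EuclideanSpace ℝ (Fin n),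
        v (i a) * ∏ t ∈ S.erase a, v (i t) = ∏ t ∈ S, v (i t) := fun v =>
      Finset.mul_prod_erase S (fun t => v (i t)) ha
    have hpos : (0 : ℝ) < n + 2 * e := by
      have := (i a).pos
      positivity
    have hterm : ∀ t ∈ ({t ∈ S.erase a | i t = i a} : Finset ι),
        ∫ v, ∏ s ∈ (S.erase a).erase t, v (i s) ∂μ =
        ((labelledMatchings i ((S.erase a).erase t)).card : ℝ) /
          ∏ j ∈ Finset.range e, ((n : ℝ) + 2 * j) := fun t ht => by
      refine ih _ ?_
      rw [Finset.card_erase_of_mem (Finset.mem_filter.mp ht).1]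
      lia
    simp only [hprod] at hrec
    rw [Finset.sum_congr rfl hterm, ← Finset.sum_div, ← Nat.cast_sum,
      ← card_labelledMatchings ha, hcard] at hrec
    rw [Finset.prod_range_succ, ← div_div, ← hrec]
    field_simp
    push_cast
    ring

theorem stmt_5 (n : ℕ) (hn : 1 ≤ n) (e : ℕ) (he : 1 ≤ e)
    (μ : Measure (EuclideanSpace ℝ (Fin n))) [IsProbabilityMeasure μ]
    (hsphere : μ (Metric.sphere (0 : EuclideanSpace ℝ (Fin n)) 1) = 1)
    (hinv : ∀ A ∈ Matrix.orthogonalGroup (Fin n) ℝ,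
      μ.map (⇑(Matrix.toEuclideanLin A :
        EuclideanSpace ℝ (Fin n) →ₗ[ℝ] EuclideanSpace ℝ (Fin n))) = μ)
    (i : Fin (2 * e) → Fin n) :
    ∫ v : EuclideanSpace ℝ (Fin n), (∏ t : Fin (2 * e), v (i t)) ∂μ =
      (Nat.card {σ : Equiv.Perm (Fin (2 * e)) // IsBrauerDiagram σ ∧ i ∘ ⇑σ = i} : ℝ) /
        ∏ j ∈ Finset.range e, ((n : ℝ) + 2 * j) := by
  have hcard : Nat.card {σ : Equiv.Perm (Fin (2 * e)) // IsBrauerDiagram σ ∧ i ∘ ⇑σ = i} =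
      (labelledMatchings i Finset.univ).card := by
    refine Nat.subtype_card _ fun σ => ?_
    simp [mem_labelledMatchings, IsBrauerDiagram, funext_iff, and_assoc]
  rw [hcard]
  exact integral_monomial_eq_card_labelledMatchings μ hsphere hinv i e Finset.univ (by simp)
end
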